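/- arXiv:2405.14248 — 2 statements merged into one kernel-verified Lean document; each statement's English description precedes it below -/
import Mathlib

section
/- For real a, b, c > 0, the integral over x from 0 to ∞ of (√(√(x²+a²)+a)/(x·√(x²+a²)))·sin(cx)·e^{-b√(x²+a²)} equals (π/√(2a))·e^{-ab}·erf(√(a(√(b²+c²)−b))). -/
open Real MeasureTheory

noncomputable def erf (z : ℝ) : ℝ := (2 / Real.sqrt π) * ∫ u in (0:ℝ)..z, Real.exp (-u^2)

open Filter Topology in
theorem integral_horizontal_line_eq_of_gaussian_bound {f : ℂ → ℂ} (hf : Differentiable ℂ f)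
    {A ε θ : ℝ} (hε : 0 < ε)
    (hbound : ∀ x : ℝ, ∀ y ∈ Set.uIcc 0 θ, ‖f (x + y * Complex.I)‖ ≤ A * exp (-ε * x ^ 2)) :
    ∫ x : ℝ, f (x + θ * Complex.I) = ∫ x : ℝ, f x := by
  have hg : Integrable fun x : ℝ => A * exp (-ε * x ^ 2) :=
    (integrable_exp_neg_mul_sq hε).const_mul A
  have hc := hf.continuous
  have hfi : ∀ y ∈ Set.uIcc 0 θ, Integrable fun x : ℝ => f (x + y * Complex.I) := fun y hy =>
    hg.mono' (by fun_prop) (.of_forall fun x => hbound x y hy)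
  have hfi0 : Integrable fun x : ℝ => f x := by simpa using hfi 0 Set.left_mem_uIcc
  have hg0 : Tendsto (fun x : ℝ => A * exp (-ε * x ^ 2)) atTop (𝓝 0) := by
    have h1 : Tendsto (fun x : ℝ => ε * x ^ 2) atTop atTop :=
      (tendsto_pow_atTop two_ne_zero).const_mul_atTop hε
    simpa [Function.comp_def] using (tendsto_exp_neg_atTop_nhds_zero.comp h1).const_mul A
  have hvert : ∀ s : ℝ → ℝ, (∀ T, s T ^ 2 = T ^ 2) →
      Tendsto (fun T => ∫ y in (0:ℝ)..θ, f (s T + y * Complex.I)) atTop (𝓝 0) := by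
    intro s hs
    refine squeeze_zero_norm (a := fun T => A * exp (-ε * T ^ 2) * |θ - 0|) (fun T => ?_)
      (by simpa using hg0.mul_const |θ - 0|)
    refine intervalIntegral.norm_integral_le_of_norm_le_const fun y hy => ?_
    rw [← hs T]
    exact hbound _ y (Set.uIoc_subset_uIcc hy)
  have hrect : ∀ T : ℝ, (∫ x in -T..T, f x) - (∫ x in -T..T, f (x + θ * Complex.I))
      + Complex.I * (∫ y in (0:ℝ)..θ, f (T + y * Complex.I))
      - Complex.I * (∫ y in (0:ℝ)..θ, f ((-T : ℝ) + y * Complex.I)) = 0 := by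
    intro T
    simpa using Complex.integral_boundary_rect_eq_zero_of_differentiableOn f (-T)
      (T + θ * Complex.I) hf.differentiableOn
  have hlim := (((intervalIntegral_tendsto_integral hfi0 tendsto_neg_atTop_atBot tendsto_id).sub
    (intervalIntegral_tendsto_integral (hfi θ Set.right_mem_uIcc)
      tendsto_neg_atTop_atBot tendsto_id)).add
    ((hvert id fun T => rfl).const_mul Complex.I)).sub
    ((hvert (fun T => -T) fun T => neg_sq T).const_mul Complex.I)
  have := tendsto_nhds_unique hlim ((tendsto_const_nhds (x := (0 : ℂ))).congr fun T => by
    simpa using (hrect T).symm)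
  simp only [mul_zero, add_zero, sub_zero] at this
  exact (sub_eq_zero.mp this).symm

theorem one_add_sq_div_two_le_cosh (t : ℝ) : 1 + t ^ 2 / 2 ≤ cosh t := by
  have h1 : cosh t = 1 + 2 * sinh (t / 2) ^ 2 := by
    have := cosh_two_mul (t / 2)
    rw [mul_div_cancel₀ t two_ne_zero, cosh_sq'] at this
    linarith
  have h2 : (t / 2) ^ 2 ≤ sinh (t / 2) ^ 2 := by
    rw [sq_le_sq, abs_sinh]
    exact self_le_sinh_iff.mpr (abs_nonneg _)
  nlinarith

theorem exp_half_sub_mul_cosh_le {κ : ℝ} (hκ : 0 < κ) (t : ℝ) :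
    exp (t / 2 - κ * cosh t) ≤ exp (1 / (4 * κ)) * exp (-(κ / 4) * t ^ 2) := by
  rw [← exp_add, exp_le_exp]
  have h1 := mul_le_mul_of_nonneg_left (one_add_sq_div_two_le_cosh t) hκ.le
  have h2 : 1 / (4 * κ) + κ / 4 * t ^ 2 - t / 2 = (κ * t - 1) ^ 2 / (4 * κ) := by
    field_simp; ring
  have h3 : 0 ≤ (κ * t - 1) ^ 2 / (4 * κ) := by positivity
  nlinarith

theorem integrable_exp_half_sub_mul_cosh {κ : ℝ} (hκ : 0 < κ) :
    Integrable fun t : ℝ => exp (t / 2 - κ * cosh t) :=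
  ((integrable_exp_neg_mul_sq (b := κ / 4) (by positivity)).const_mul (exp (1 / (4 * κ)))).mono'
    (by fun_prop) (.of_forall fun t => by
      rw [norm_of_nonneg (exp_pos _).le]; exact exp_half_sub_mul_cosh_le hκ t)

theorem integral_comp_sinh_mul_cosh (f : ℝ → ℝ) : ∫ t, cosh t * f (sinh t) = ∫ x, f x := by
  have := integral_image_eq_integral_abs_deriv_smul (s := Set.univ) (f := sinh) (f' := cosh)
    MeasurableSet.univ (fun x _ => (hasDerivAt_sinh x).hasDerivWithinAt)
    sinh_injective.injOn f
  rw [Set.image_univ, sinh_surjective.range_eq] at this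
  simpa [abs_of_pos (cosh_pos _)] using this.symm

theorem integral_exp_half_mul_even {g : ℝ → ℝ} (hg : ∀ t, g (-t) = g t)
    (hi : Integrable fun t => exp (t / 2) * g t) :
    ∫ t, exp (t / 2) * g t = ∫ t, cosh (t / 2) * g t := by
  have hi' : Integrable fun t => exp (-t / 2) * g t := by simpa [hg] using hi.comp_neg
  have h2 : ∫ t, exp (-t / 2) * g t = ∫ t, exp (t / 2) * g t := by
    simpa [hg] using integral_neg_eq_self (fun t => exp (t / 2) * g t) volume
  have h3 : ∫ t, cosh (t / 2) * g t
      = 2⁻¹ * ((∫ t, exp (t / 2) * g t) + ∫ t, exp (-t / 2) * g t) := by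
    rw [← integral_add hi hi', ← integral_const_mul]
    congr 1 with t
    rw [cosh_eq, neg_div]; ring
  rw [h3, h2]; ring

theorem integral_exp_half_sub_mul_cosh {z : ℝ} (hz : 0 < z) :
    ∫ t : ℝ, exp (t / 2 - z * cosh t) = √(2 * π / z) * exp (-z) := by
  have h1 : ∫ t : ℝ, exp (t / 2 - z * cosh t) = ∫ t : ℝ, cosh (t / 2) * exp (-(z * cosh t)) := by
    rw [← integral_exp_half_mul_even (by simp)]
    · simp only [← exp_add, sub_eq_add_neg]
    · simpa only [← exp_add, ← sub_eq_add_neg] using integrable_exp_half_sub_mul_cosh hz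
  have h2 : ∀ t : ℝ, cosh (t / 2) * exp (-(z * cosh t))
      = (fun u => exp (-z) * (cosh u * exp (-(2 * z) * sinh u ^ 2))) (t / 2) := by
    intro t
    have := cosh_two_mul (t / 2)
    rw [mul_div_cancel₀ t two_ne_zero, cosh_sq'] at this
    rw [this]
    simp only [mul_left_comm (exp (-z)), ← exp_add]
    ring_nf
  rw [h1]
  simp_rw [h2]
  rw [Measure.integral_comp_div (fun u => exp (-z) * (cosh u * exp (-(2 * z) * sinh u ^ 2))),
    integral_const_mul, integral_comp_sinh_mul_cosh (fun x => exp (-(2 * z) * x ^ 2)),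
    integral_gaussian]
  have : (2 : ℝ) * √(π / (2 * z)) = √(2 * π / z) := by
    rw [show (2 : ℝ) * π / z = 2 ^ 2 * (π / (2 * z)) by field_simp,
      Real.sqrt_mul (by positivity), Real.sqrt_sq (by positivity)]
  rw [← this, abs_of_pos two_pos, smul_eq_mul]; ring

theorem integral_exp_half_sub_mul_cosh_mul_cos {z θ : ℝ} (hz : 0 < z) (hθ : |θ| < π / 2) :
    ∫ t : ℝ, exp (t / 2 - z * cos θ * cosh t) * cos (z * sin θ * sinh t)
      = √(2 * π / z) * exp (-z) * cos (θ / 2) := by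
  have hcos : 0 < cos θ := cos_pos_of_mem_Ioo (abs_lt.mp hθ)
  set f : ℂ → ℂ := fun w => Complex.exp (w / 2 - z * Complex.cosh w) with hfdef
  have hexp : ∀ p q : ℝ, ‖Complex.exp (p + q * Complex.I)‖ = exp p := by
    intro p q; simp [Complex.norm_exp]
  have hsplit : ∀ t y : ℝ, f (t + y * Complex.I) = Complex.exp ((y / 2 : ℝ) * Complex.I) *
      Complex.exp ((t / 2 - z * cos y * cosh t : ℝ) + (-(z * sin y * sinh t) : ℝ) * Complex.I) := by
    intro t y
    rw [hfdef, ← Complex.exp_add]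
    simp only [Complex.cosh_add, Complex.cosh_mul_I, Complex.sinh_mul_I]
    push_cast
    ring_nf
  have hnorm : ∀ t y : ℝ, ‖f (t + y * Complex.I)‖ = exp (t / 2 - z * cos y * cosh t) := by
    intro t y
    rw [hsplit, norm_mul, hexp, Complex.norm_exp_ofReal_mul_I, one_mul]
  have hshift := integral_horizontal_line_eq_of_gaussian_bound (f := f) (by fun_prop)
    (A := exp (1 / (4 * (z * cos θ)))) (ε := z * cos θ / 4) (θ := θ) (by positivity) (by
      intro t y hy
      rw [hnorm]
      refine le_trans ?_ (exp_half_sub_mul_cosh_le (κ := z * cos θ) (by positivity) t)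
      have hy' : |y| ≤ |θ| := by simpa using Set.abs_sub_left_of_mem_uIcc hy
      have : cos θ ≤ cos y := by
        rw [← cos_abs θ, ← cos_abs y]
        exact cos_le_cos_of_nonneg_of_le_pi (abs_nonneg y) (by linarith [pi_pos]) hy'
      have := cosh_pos t
      gcongr)
  have h0 : ∫ t : ℝ, f t = (√(2 * π / z) * exp (-z) : ℝ) := by
    rw [← integral_exp_half_sub_mul_cosh hz, ← integral_complex_ofReal]
    simp [hfdef]
  have hfi : Integrable fun t : ℝ => Complex.exp ((t / 2 - z * cos θ * cosh t : ℝ)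
      + (-(z * sin θ * sinh t) : ℝ) * Complex.I) :=
    (integrable_exp_half_sub_mul_cosh (κ := z * cos θ) (by positivity)).mono' (by fun_prop)
      (.of_forall fun t => (hexp _ _).le)
  rw [h0] at hshift
  simp_rw [hsplit] at hshift
  rw [integral_const_mul] at hshift
  have key : ∫ t : ℝ, Complex.exp ((t / 2 - z * cos θ * cosh t : ℝ)
      + (-(z * sin θ * sinh t) : ℝ) * Complex.I)
      = (√(2 * π / z) * exp (-z) : ℝ) * Complex.exp ((-(θ / 2) : ℝ) * Complex.I) := by
    rw [← hshift, mul_right_comm, ← Complex.exp_add]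
    simp
  have hre := congrArg Complex.re key
  rw [Complex.re_ofReal_mul, Complex.exp_ofReal_mul_I_re, cos_neg,
    ← RCLike.re_eq_complex_re, ← integral_re hfi] at hre
  rw [← hre]
  congr 1 with t
  rw [Complex.exp_add, ← Complex.ofReal_exp, RCLike.re_eq_complex_re, Complex.re_ofReal_mul,
    Complex.exp_ofReal_mul_I_re, cos_neg]

theorem integral_cos_mul_exp_neg_sqrt {a b : ℝ} (ha : 0 < a) (hb : 0 < b) (s : ℝ) :
    ∫ x in Set.Ioi (0:ℝ), √(√(x ^ 2 + a ^ 2) + a) / √(x ^ 2 + a ^ 2)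
        * exp (-b * √(x ^ 2 + a ^ 2)) * cos (s * x)
      = √(π / 2) * √(√(b ^ 2 + s ^ 2) + b) / √(b ^ 2 + s ^ 2) * exp (-(a * √(b ^ 2 + s ^ 2))) := by
  set R := √(b ^ 2 + s ^ 2) with hR
  have hRpos : 0 < R := by positivity
  have hsq : √(1 + (s / b) ^ 2) = R / b := by
    rw [show 1 + (s / b) ^ 2 = (b ^ 2 + s ^ 2) / b ^ 2 by field_simp,
      Real.sqrt_div (by positivity), Real.sqrt_sq hb.le]
  set θ := arctan (s / b) with hθ
  have hcos : cos θ = b / R := by rw [hθ, cos_arctan, hsq]; field_simp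
  have hsin : sin θ = s / R := by rw [hθ, sin_arctan, hsq]; field_simp
  have hmem := arctan_mem_Ioo (s / b)
  have habs : |θ| < π / 2 := abs_lt.mpr hmem
  have hmain := integral_exp_half_sub_mul_cosh_mul_cos (z := a * R) (by positivity) habs
  rw [cos_half (by linarith [hmem.1, pi_pos]) (by linarith [hmem.2, pi_pos]), hcos, hsin,
    show a * R * (b / R) = a * b by field_simp, show a * R * (s / R) = a * s by field_simp]
    at hmain
  have hsplit : ∀ t : ℝ, exp (t / 2 - a * b * cosh t) * cos (a * s * sinh t)
      = exp (t / 2) * (exp (-(a * b * cosh t)) * cos (a * s * sinh t)) := by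
    intro t; rw [← mul_assoc, ← exp_add, sub_eq_add_neg]
  have hfi : Integrable fun t : ℝ =>
      exp (t / 2) * (exp (-(a * b * cosh t)) * cos (a * s * sinh t)) := by
    simp_rw [← hsplit]
    refine (integrable_exp_half_sub_mul_cosh (κ := a * b) (by positivity)).mono' (by fun_prop)
      (.of_forall fun t => ?_)
    rw [norm_mul, norm_of_nonneg (exp_pos _).le]
    exact mul_le_of_le_one_right (exp_pos _).le (abs_cos_le_one _)
  simp_rw [hsplit] at hmain
  rw [integral_exp_half_mul_even (by simp) hfi] at hmain
  set g : ℝ → ℝ := fun x => √(√(x ^ 2 + a ^ 2) + a) / √(x ^ 2 + a ^ 2)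
        * exp (-b * √(x ^ 2 + a ^ 2)) * cos (s * x) with hg
  have hhalf : ∫ x, g x = 2 * ∫ x in Set.Ioi (0:ℝ), g x := by
    rw [← integral_comp_abs]
    congr 1 with x
    rcases abs_cases x with h | h <;> simp [hg, h.1]
  have hsubst : ∫ x, g x = √(2 * a) *
      ∫ t, cosh (t / 2) * (exp (-(a * b * cosh t)) * cos (a * s * sinh t)) := by
    have h1 := Measure.integral_comp_mul_left g a
    rw [abs_of_pos (inv_pos.mpr ha), smul_eq_mul] at h1
    have h2 : ∫ x, g x = a * ∫ x, g (a * x) := by rw [h1]; field_simp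
    rw [h2, ← integral_comp_sinh_mul_cosh (fun x => g (a * x)), ← integral_const_mul,
      ← integral_const_mul]
    congr 1 with t
    have hc := cosh_pos t
    have hr : √((a * sinh t) ^ 2 + a ^ 2) = a * cosh t := by
      rw [show (a * sinh t) ^ 2 + a ^ 2 = (a * cosh t) ^ 2 by rw [mul_pow, mul_pow, cosh_sq']; ring,
        Real.sqrt_sq (by positivity)]
    have hn : √(a * cosh t + a) = √(2 * a) * cosh (t / 2) := by
      have := cosh_two_mul (t / 2)
      rw [mul_div_cancel₀ t two_ne_zero, sinh_sq] at this
      rw [show a * cosh t + a = 2 * a * cosh (t / 2) ^ 2 by rw [this]; ring,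
        Real.sqrt_mul (by positivity), Real.sqrt_sq (cosh_pos _).le]
    simp only [hg, hr, hn]
    field_simp
  have hconst : √(2 * a) * √(2 * π / (a * R)) * √((1 + b / R) / 2)
      = 2 * (√(π / 2) * √(R + b) / R) := by
    rw [← Real.sqrt_mul (by positivity), ← Real.sqrt_mul (by positivity),
      ← Real.sqrt_mul (by positivity),
      show 2 * a * (2 * π / (a * R)) * ((1 + b / R) / 2) = 2 ^ 2 * (π / 2 * (R + b)) / R ^ 2 by
        field_simp,
      Real.sqrt_div (by positivity), Real.sqrt_mul (by positivity), Real.sqrt_sq hRpos.le,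
      Real.sqrt_sq two_pos.le]
    ring
  rw [hmain] at hsubst
  linear_combination (-1 / 2) * hhalf + (1 / 2) * hsubst + exp (-(a * R)) / 2 * hconst

theorem hasDerivAt_erf (z : ℝ) : HasDerivAt erf (2 / √π * exp (-z ^ 2)) z :=
  (intervalIntegral.integral_hasDerivAt_right (Continuous.intervalIntegrable (by fun_prop) _ _)
    (Continuous.stronglyMeasurableAtFilter (by fun_prop) _ _)
    (by fun_prop)).const_mul _

theorem continuous_erf : Continuous erf :=
  continuous_iff_continuousAt.mpr fun z => (hasDerivAt_erf z).continuousAt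

theorem hasDerivAt_erf_sqrt {a b s : ℝ} (ha : 0 < a) (hb : 0 < b) (hs : 0 < s) :
    HasDerivAt (fun s => π / √(2 * a) * exp (-(a * b)) * erf √(a * (√(b ^ 2 + s ^ 2) - b)))
      (√(π / 2) * √(√(b ^ 2 + s ^ 2) + b) / √(b ^ 2 + s ^ 2) * exp (-(a * √(b ^ 2 + s ^ 2)))) s := by
  set R := √(b ^ 2 + s ^ 2) with hR
  have hRpos : 0 < R := by positivity
  have hR2 : R ^ 2 = b ^ 2 + s ^ 2 := Real.sq_sqrt (by positivity)
  have hRb : 0 < R - b := by nlinarith [sq_pos_of_pos hs]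
  have h1 : HasDerivAt (fun s : ℝ => √(b ^ 2 + s ^ 2)) (s / R) s := by
    refine (((hasDerivAt_pow 2 s).const_add (b ^ 2)).sqrt (by positivity)).congr_deriv ?_
    rw [← hR]; field_simp; norm_num
  have h2 := ((h1.sub_const b).const_mul a).sqrt (mul_pos ha hRb).ne'
  have h3 := ((hasDerivAt_erf _).comp s h2).const_mul (π / √(2 * a) * exp (-(a * b)))
  refine h3.congr_deriv ?_
  rw [← hR, Real.sq_sqrt (mul_pos ha hRb).le,
    show exp (-(a * R)) = exp (-(a * b)) * exp (-(a * (R - b))) by rw [← exp_add]; ring_nf,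
    Real.sqrt_mul ha.le, Real.sqrt_mul two_pos.le,
    Real.sqrt_div pi_pos.le]
  have hs_eq : s = √(R - b) * √(R + b) := by
    rw [← Real.sqrt_mul hRb.le, show (R - b) * (R + b) = s ^ 2 by linear_combination hR2,
      Real.sqrt_sq hs.le]
  have ha2 : √a ^ 2 = a := Real.sq_sqrt ha.le
  have hp2 : √π ^ 2 = π := Real.sq_sqrt pi_pos.le
  have := Real.sqrt_pos.mpr ha
  have := Real.sqrt_pos.mpr hRb
  have := Real.sqrt_pos.mpr pi_pos
  rw [hs_eq]
  field_simp
  rw [ha2, hp2, mul_comm]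

theorem integrableOn_sqrt_div_mul_exp {a b : ℝ} (ha : 0 < a) (hb : 0 < b) :
    IntegrableOn (fun x : ℝ => √(√(x ^ 2 + a ^ 2) + a) / √(x ^ 2 + a ^ 2)
        * exp (-b * √(x ^ 2 + a ^ 2))) (Set.Ioi 0) := by
  have hmeas : Continuous fun x : ℝ => √(√(x ^ 2 + a ^ 2) + a) / √(x ^ 2 + a ^ 2)
        * exp (-b * √(x ^ 2 + a ^ 2)) := by
    have : ∀ x : ℝ, √(x ^ 2 + a ^ 2) ≠ 0 := fun x => by positivity
    fun_prop (disch := assumption)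
  refine ((exp_neg_integrableOn_Ioi 0 hb).const_mul (√(2 / a))).mono' hmeas.aestronglyMeasurable
    ((ae_restrict_mem measurableSet_Ioi).mono fun x hx => ?_)
  have hx0 : 0 < x := hx
  set r := √(x ^ 2 + a ^ 2)
  have hxr : x ≤ r := Real.le_sqrt_of_sq_le (by nlinarith)
  have har : a ≤ r := Real.le_sqrt_of_sq_le (by nlinarith)
  have hr : 0 < r := by linarith
  rw [norm_of_nonneg (by positivity)]
  gcongr ?_ * ?_
  · rw [div_le_iff₀ hr]
    refine Real.sqrt_le_iff.mpr ⟨by positivity, ?_⟩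
    rw [mul_pow, Real.sq_sqrt (by positivity), div_mul_eq_mul_div, le_div_iff₀ ha]
    nlinarith [mul_le_mul har har ha.le hr.le, mul_le_mul_of_nonneg_left har hr.le]
  · rw [exp_le_exp]; nlinarith

theorem stmt10 (a b c : ℝ) (ha : 0 < a) (hb : 0 < b) (hc : 0 < c) :
    ∫ x in Set.Ioi (0:ℝ),
        Real.sqrt (Real.sqrt (x^2 + a^2) + a) / (x * Real.sqrt (x^2 + a^2))
          * Real.sin (c * x) * Real.exp (-b * Real.sqrt (x^2 + a^2))
      = π / Real.sqrt (2 * a) * Real.exp (-(a * b))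
        * erf (Real.sqrt (a * (Real.sqrt (b^2 + c^2) - b))) := by
  set k : ℝ → ℝ := fun x => √(√(x ^ 2 + a ^ 2) + a) / √(x ^ 2 + a ^ 2)
        * exp (-b * √(x ^ 2 + a ^ 2)) with hk
  have hinner : ∀ x ∈ Set.Ioi (0:ℝ), √(√(x ^ 2 + a ^ 2) + a) / (x * √(x ^ 2 + a ^ 2))
          * sin (c * x) * exp (-b * √(x ^ 2 + a ^ 2)) = ∫ s in (0:ℝ)..c, k x * cos (s * x) := by
    intro x hx
    have hx0 : x ≠ 0 := (Set.mem_Ioi.mp hx).ne'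
    rw [intervalIntegral.integral_const_mul, intervalIntegral.integral_comp_mul_right _ hx0,
      integral_cos, hk]
    simp only [zero_mul, sin_zero, sub_zero, smul_eq_mul]
    field_simp
  have hprod : Integrable (Function.uncurry fun x s => k x * cos (s * x))
      ((volume.restrict (Set.Ioi 0)).prod (volume.restrict (Set.Ioc 0 c))) := by
    have h1 : Integrable (fun p : ℝ × ℝ => k p.1 * 1)
        ((volume.restrict (Set.Ioi 0)).prod (volume.restrict (Set.Ioc 0 c))) :=
      (integrableOn_sqrt_div_mul_exp ha hb).mul_prod (integrable_const 1)
    simp only [mul_one] at h1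
    refine h1.mul_bdd (c := 1) (g := fun p : ℝ × ℝ => cos (p.2 * p.1))
      (by fun_prop) (.of_forall fun p => abs_cos_le_one _)
  rw [setIntegral_congr_fun measurableSet_Ioi hinner]
  simp_rw [intervalIntegral.integral_of_le hc.le]
  rw [integral_integral_swap hprod]
  simp_rw [hk, integral_cos_mul_exp_neg_sqrt ha hb]
  rw [← intervalIntegral.integral_of_le hc.le,
    intervalIntegral.integral_eq_sub_of_hasDerivAt_of_le hc.le (f := fun s =>
      π / √(2 * a) * exp (-(a * b)) * erf √(a * (√(b ^ 2 + s ^ 2) - b)))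
      (Continuous.continuousOn (by have := continuous_erf; fun_prop))
      (fun s hs => hasDerivAt_erf_sqrt ha hb hs.1)]
  · simp [Real.sqrt_sq hb.le, erf]
  · have : ∀ s : ℝ, √(b ^ 2 + s ^ 2) ≠ 0 := fun s => by positivity
    exact Continuous.intervalIntegrable (by fun_prop (disch := assumption)) _ _
end

section
/- For real a, b, c > 0, the integral over x from 0 to ∞ of (√(√(x²+a²)−a)/√(x²+a²))·sin(cx)·e^{-b√(x²+a²)} equals √(π/2) · √(√(b²+c²)−b)/√(b²+c²) · e^{-a√(b²+c²)}. -/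
open Real MeasureTheory

open Filter Topology

/-- Shifting the line of integration of an entire function which is dominated on a horizontal strip
by an integrable function of the real part vanishing at infinity. -/
lemma integral_add_mul_I_eq_integral {f : ℂ → ℂ} {h : ℝ → ℝ} {y₀ : ℝ} (hf : Differentiable ℂ f)
    (hh : Integrable h)
    (hfh : ∀ x : ℝ, ∀ y ∈ Set.uIcc 0 y₀, ‖f (x + y * Complex.I)‖ ≤ h x)
    (htop : Tendsto h atTop (𝓝 0)) (hbot : Tendsto h atBot (𝓝 0)) :
    ∫ x : ℝ, f (x + y₀ * Complex.I) = ∫ x : ℝ, f x := by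
  have hint : ∀ y ∈ Set.uIcc 0 y₀, Integrable fun x : ℝ => f (x + y * Complex.I) := by
    intro y hy
    refine hh.mono' ?_ (Eventually.of_forall fun x => hfh x y hy)
    exact (hf.continuous.comp (by fun_prop)).aestronglyMeasurable
  have hint₀ : Integrable fun x : ℝ => f x := by
    simpa using hint 0 Set.left_mem_uIcc
  have hlim := (intervalIntegral_tendsto_integral hint₀ tendsto_neg_atTop_atBot tendsto_id).sub
    (intervalIntegral_tendsto_integral (hint y₀ Set.right_mem_uIcc) tendsto_neg_atTop_atBot
      tendsto_id)
  have hvert : ∀ {u : ℝ → ℝ}, Tendsto (fun T => h (u T)) atTop (𝓝 0) →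
      Tendsto (fun T => Complex.I • ∫ y : ℝ in 0..y₀, f (u T + y * Complex.I)) atTop (𝓝 0) := by
    intro u hu
    refine squeeze_zero_norm (a := fun T => h (u T) * |y₀ - 0|) (fun T => ?_) (by
      simpa using hu.mul_const |y₀ - 0|)
    rw [norm_smul, Complex.norm_I, one_mul]
    exact intervalIntegral.norm_integral_le_of_norm_le_const fun y hy =>
      hfh _ _ (Set.uIoc_subset_uIcc hy)
  have hlim' := (hvert (u := fun T => -T) (hbot.comp tendsto_neg_atTop_atBot)).sub
    (hvert (u := fun T => T) htop)
  have hrect : ∀ T : ℝ, (∫ x : ℝ in -T..T, f x) - (∫ x : ℝ in -T..T, f (x + y₀ * Complex.I)) =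
      Complex.I • (∫ y : ℝ in 0..y₀, f ((-T : ℝ) + y * Complex.I)) -
        Complex.I • ∫ y : ℝ in 0..y₀, f (T + y * Complex.I) := by
    intro T
    have := Complex.integral_boundary_rect_eq_zero_of_differentiableOn f ((-T : ℝ) : ℂ)
      (T + y₀ * Complex.I) hf.differentiableOn
    simp at this
    simp
    linear_combination this
  have := tendsto_nhds_unique (hlim.congr hrect) hlim'
  rw [sub_zero, sub_eq_zero] at this
  exact this.symm

lemma cosh_eq_one_add_two_mul_sinh_half_sq (x : ℝ) : cosh x = 1 + 2 * sinh (x / 2) ^ 2 := by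
  have := Real.cosh_two_mul (x / 2)
  rw [mul_div_cancel₀ x two_ne_zero] at this
  rw [this, Real.cosh_sq]
  ring

lemma hasDerivAt_sinh_half (x : ℝ) : HasDerivAt (fun x : ℝ => sinh (x / 2)) (cosh (x / 2) / 2) x := by
  simpa [div_eq_mul_inv] using ((hasDerivAt_id x).div_const 2).sinh

lemma sinh_half_injective : Function.Injective fun x : ℝ => sinh (x / 2) := fun x y h => by
  have := sinh_injective h
  linarith

lemma image_sinh_half_univ : (fun x : ℝ => sinh (x / 2)) '' Set.univ = Set.univ := by
  rw [Set.image_univ, Set.range_eq_univ]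
  intro y
  exact ⟨2 * arsinh y, by simp⟩

lemma cosh_half_mul_exp_neg_mul_cosh (k x : ℝ) : cosh (x / 2) * exp (-k * cosh x) =
    2 * exp (-k) * (|cosh (x / 2) / 2| • exp (-(2 * k) * sinh (x / 2) ^ 2)) := by
  rw [abs_of_pos (by positivity), cosh_eq_one_add_two_mul_sinh_half_sq x,
    show -k * (1 + 2 * sinh (x / 2) ^ 2) = -k + -(2 * k) * sinh (x / 2) ^ 2 by ring, exp_add,
    smul_eq_mul]
  ring

lemma integrable_cosh_half_mul_exp_neg_mul_cosh {k : ℝ} (hk : 0 < k) :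
    Integrable fun x : ℝ => cosh (x / 2) * exp (-k * cosh x) := by
  simp_rw [cosh_half_mul_exp_neg_mul_cosh]
  refine Integrable.const_mul ?_ _
  rw [← integrableOn_univ, ← integrableOn_image_iff_integrableOn_abs_deriv_smul MeasurableSet.univ
    (fun x _ => (hasDerivAt_sinh_half x).hasDerivWithinAt) sinh_half_injective.injOn
    (fun u => exp (-(2 * k) * u ^ 2)), image_sinh_half_univ, integrableOn_univ]
  exact integrable_exp_neg_mul_sq (by positivity)

lemma integral_cosh_half_mul_exp_neg_mul_cosh (k : ℝ) :
    ∫ x : ℝ, cosh (x / 2) * exp (-k * cosh x) = 2 * exp (-k) * √(π / (2 * k)) := by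
  simp_rw [cosh_half_mul_exp_neg_mul_cosh]
  rw [integral_const_mul, ← setIntegral_univ, ← integral_image_eq_integral_abs_deriv_smul
    MeasurableSet.univ (fun x _ => (hasDerivAt_sinh_half x).hasDerivWithinAt)
    sinh_half_injective.injOn (fun u => exp (-(2 * k) * u ^ 2)), image_sinh_half_univ,
    setIntegral_univ, integral_gaussian]

lemma tendsto_cosh_half_mul_exp_neg_mul_cosh_atTop {k : ℝ} (hk : 0 < k) :
    Tendsto (fun x : ℝ => cosh (x / 2) * exp (-k * cosh x)) atTop (𝓝 0) := by
  have hlim : Tendsto (fun x : ℝ => (k * (x / 2))⁻¹) atTop (𝓝 0) :=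
    ((tendsto_id.atTop_div_const two_pos).const_mul_atTop hk).inv_tendsto_atTop
  refine squeeze_zero' (Eventually.of_forall fun x => by positivity) ?_ hlim
  filter_upwards [eventually_gt_atTop 0] with x hx
  have hc : 0 < cosh (x / 2) := cosh_pos _
  have h₁ : x / 2 ≤ cosh (x / 2) :=
    (self_le_sinh_iff.2 (by positivity)).trans (sinh_lt_cosh _).le
  have h₂ : cosh (x / 2) ^ 2 ≤ cosh x := by
    rw [cosh_eq_one_add_two_mul_sinh_half_sq x, Real.cosh_sq]
    nlinarith [sq_nonneg (sinh (x / 2))]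
  have h₃ : k * cosh x ≤ exp (k * cosh x) := by linarith [add_one_le_exp (k * cosh x)]
  calc cosh (x / 2) * exp (-k * cosh x) = cosh (x / 2) / exp (k * cosh x) := by
        rw [neg_mul, exp_neg, ← div_eq_mul_inv]
    _ ≤ cosh (x / 2) / (k * cosh (x / 2) ^ 2) := by
        gcongr
        exact (mul_le_mul_of_nonneg_left h₂ hk.le).trans h₃
    _ = (k * cosh (x / 2))⁻¹ := by field_simp
    _ ≤ (k * (x / 2))⁻¹ := by gcongr

lemma tendsto_cosh_half_mul_exp_neg_mul_cosh_atBot {k : ℝ} (hk : 0 < k) :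
    Tendsto (fun x : ℝ => cosh (x / 2) * exp (-k * cosh x)) atBot (𝓝 0) := by
  simpa [Function.comp_def, neg_div] using
    (tendsto_cosh_half_mul_exp_neg_mul_cosh_atTop hk).comp tendsto_neg_atBot_atTop

lemma norm_sinh_le_cosh_re (z : ℂ) : ‖Complex.sinh z‖ ≤ cosh z.re := by
  rw [Complex.sinh, Real.cosh_eq, norm_div, Complex.norm_ofNat]
  gcongr
  refine (norm_sub_le _ _).trans_eq ?_
  simp [Complex.norm_exp]

lemma norm_sinh_half_mul_cexp_le {k φ : ℝ} (hk : 0 < k) (hφ₀ : 0 ≤ φ) (hφ : φ < π / 2) (x : ℝ)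
    {y : ℝ} (hy : y ∈ Set.uIcc 0 (-φ)) :
    ‖Complex.sinh ((x + y * Complex.I + φ * Complex.I) / 2) *
      Complex.exp (-k * Complex.cosh (x + y * Complex.I))‖ ≤
      cosh (x / 2) * exp (-(k * cos φ) * cosh x) := by
  rw [Set.uIcc_of_ge (by linarith)] at hy
  have hy' : cos φ ≤ cos y := by
    rw [← cos_neg y]
    exact cos_le_cos_of_nonneg_of_le_pi (by linarith [hy.2]) (by linarith [pi_pos])
      (by linarith [hy.1])
  rw [norm_mul, Complex.norm_exp]
  gcongr
  · refine (norm_sinh_le_cosh_re _).trans_eq ?_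
    simp
  · have hre : (-(k : ℂ) * Complex.cosh (x + y * Complex.I)).re = -(k * cos y) * cosh x := by
      rw [Complex.cosh_add, Complex.cosh_mul_I, Complex.sinh_mul_I, ← Complex.ofReal_cosh,
        ← Complex.ofReal_sinh, ← Complex.ofReal_cos, ← Complex.ofReal_sin]
      simp [-Complex.ofReal_cos, -Complex.ofReal_sin]
      ring
    rw [hre]
    have := cosh_pos x
    gcongr

lemma integrable_sinh_half_mul_cexp {k φ : ℝ} (hk : 0 < k) (hφ₀ : 0 ≤ φ) (hφ : φ < π / 2)
    {y : ℝ} (hy : y ∈ Set.uIcc 0 (-φ)) :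
    Integrable fun x : ℝ => Complex.sinh ((x + y * Complex.I + φ * Complex.I) / 2) *
      Complex.exp (-k * Complex.cosh (x + y * Complex.I)) :=
  (integrable_cosh_half_mul_exp_neg_mul_cosh
    (mul_pos hk (cos_pos_of_mem_Ioo ⟨by linarith [pi_pos], hφ⟩))).mono'
    (Continuous.aestronglyMeasurable (by fun_prop))
    (Eventually.of_forall fun x => norm_sinh_half_mul_cexp_le hk hφ₀ hφ x hy)

lemma integral_sinh_half_mul_sin_mul_exp {k φ : ℝ} (hk : 0 < k) (hφ₀ : 0 ≤ φ) (hφ : φ < π / 2) :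
    ∫ x : ℝ, sinh (x / 2) * sin (k * sin φ * sinh x) * exp (-(k * cos φ) * cosh x) =
      sin (φ / 2) * (2 * exp (-k) * √(π / (2 * k))) := by
  have hκ : 0 < k * cos φ := mul_pos hk (cos_pos_of_mem_Ioo ⟨by linarith [pi_pos], hφ⟩)
  have key := integral_add_mul_I_eq_integral (y₀ := -φ)
    (f := fun z => Complex.sinh ((z + φ * Complex.I) / 2) * Complex.exp (-k * Complex.cosh z))
    (by fun_prop) (integrable_cosh_half_mul_exp_neg_mul_cosh hκ)
    (fun x y hy => norm_sinh_half_mul_cexp_le hk hφ₀ hφ x hy)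
    (tendsto_cosh_half_mul_exp_neg_mul_cosh_atTop hκ)
    (tendsto_cosh_half_mul_exp_neg_mul_cosh_atBot hκ)
  have hint := integrable_sinh_half_mul_cexp hk hφ₀ hφ Set.right_mem_uIcc
  have hint₀ : Integrable fun x : ℝ => Complex.sinh ((x + φ * Complex.I) / 2) *
      Complex.exp (-k * Complex.cosh x) := by
    simpa using integrable_sinh_half_mul_cexp hk hφ₀ hφ Set.left_mem_uIcc
  have him := congrArg Complex.im key
  rw [← RCLike.im_eq_complex_im, ← integral_im hint, ← integral_im hint₀] at him
  rw [← integral_cosh_half_mul_exp_neg_mul_cosh, ← integral_const_mul]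
  convert him using 1
  · congr with x
    rw [RCLike.im_eq_complex_im,
      show ((x : ℂ) + (-φ : ℝ) * Complex.I + φ * Complex.I) / 2 = ((x / 2 : ℝ) : ℂ) by
        push_cast; ring,
      ← Complex.ofReal_sinh, Complex.im_ofReal_mul, Complex.exp_im, Complex.cosh_add,
      Complex.cosh_mul_I, Complex.sinh_mul_I, ← Complex.ofReal_cosh,
      ← Complex.ofReal_sinh, ← Complex.ofReal_cos, ← Complex.ofReal_sin, cos_neg, sin_neg]
    simp [-Complex.ofReal_cos, -Complex.ofReal_sin, -Complex.ofReal_cosh, -Complex.ofReal_sinh]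
    ring_nf
  · congr with x
    rw [RCLike.im_eq_complex_im,
      show ((x : ℂ) + φ * Complex.I) / 2 = ((x / 2 : ℝ) : ℂ) + (φ / 2 : ℝ) * Complex.I by
        push_cast; ring,
      show -(k : ℂ) * Complex.cosh x = ((-k * cosh x : ℝ) : ℂ) by push_cast; ring,
      ← Complex.ofReal_exp, Complex.im_mul_ofReal, Complex.sinh_add,
      Complex.cosh_mul_I, Complex.sinh_mul_I, ← Complex.ofReal_cosh,
      ← Complex.ofReal_sinh, ← Complex.ofReal_cos, ← Complex.ofReal_sin]
    simp [-Complex.ofReal_cos, -Complex.ofReal_sin, -Complex.ofReal_cosh, -Complex.ofReal_sinh]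
    ring

lemma integral_Ioi_eq_integral_Ioi_mul_sinh {a : ℝ} (ha : 0 < a) (g : ℝ → ℝ) :
    ∫ x in Set.Ioi (0 : ℝ), g x = ∫ t in Set.Ioi (0 : ℝ), a * cosh t * g (a * sinh t) := by
  have himage : (fun t => a * sinh t) '' Set.Ioi 0 = Set.Ioi 0 := by
    ext x
    constructor
    · rintro ⟨t, ht, rfl⟩
      exact mul_pos ha (sinh_pos_iff.2 ht)
    · intro hx
      refine ⟨arsinh (x / a), arsinh_pos_iff.2 (div_pos hx ha), ?_⟩
      simp only [sinh_arsinh]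
      field_simp
  have := integral_image_eq_integral_abs_deriv_smul (measurableSet_Ioi (a := (0 : ℝ)))
    (fun t _ => ((hasDerivAt_sinh t).const_mul a).hasDerivWithinAt)
    (fun x _ y _ h => sinh_injective (mul_left_cancel₀ ha.ne' h)) g
  rw [himage] at this
  rw [this]
  congr with t
  rw [abs_of_pos (by positivity), smul_eq_mul]

theorem stmt15 (a b c : ℝ) (ha : 0 < a) (hb : 0 < b) (hc : 0 < c) :
    ∫ x in Set.Ioi (0:ℝ),
        Real.sqrt (Real.sqrt (x^2 + a^2) - a) / Real.sqrt (x^2 + a^2)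
          * Real.sin (c * x) * Real.exp (-b * Real.sqrt (x^2 + a^2))
      = Real.sqrt (π / 2) * Real.sqrt (Real.sqrt (b^2 + c^2) - b) / Real.sqrt (b^2 + c^2)
        * Real.exp (-a * Real.sqrt (b^2 + c^2)) := by
  have hsub : ∀ t ∈ Set.Ioi (0 : ℝ), a * cosh t *
      (√(√((a * sinh t) ^ 2 + a ^ 2) - a) / √((a * sinh t) ^ 2 + a ^ 2) * sin (c * (a * sinh t)) *
        exp (-b * √((a * sinh t) ^ 2 + a ^ 2))) =
      √(2 * a) * (sinh (|t| / 2) * sin (a * c * sinh |t|) * exp (-(a * b) * cosh |t|)) := by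
    intro t ht
    have ht : 0 < t := ht
    have hcosh : 0 < cosh t := cosh_pos t
    have h₁ : √((a * sinh t) ^ 2 + a ^ 2) = a * cosh t := by
      rw [← sqrt_sq (mul_pos ha hcosh).le, mul_pow a (cosh t), Real.cosh_sq]
      ring_nf
    have h₂ : √(a * cosh t - a) = √(2 * a) * sinh (t / 2) := by
      rw [cosh_eq_one_add_two_mul_sinh_half_sq,
        show a * (1 + 2 * sinh (t / 2) ^ 2) - a = 2 * a * sinh (t / 2) ^ 2 by ring,
        sqrt_mul (by positivity), sqrt_sq (sinh_nonneg_iff.2 (by positivity))]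
    rw [h₁, h₂, abs_of_pos ht, show c * (a * sinh t) = a * c * sinh t by ring,
      show -b * (a * cosh t) = -(a * b) * cosh t by ring]
    field_simp
  set r := √(b ^ 2 + c ^ 2) with hr
  have hr₀ : 0 < r := by positivity
  have hbr : b < r := lt_sqrt_of_sq_lt (by nlinarith)
  set z : ℂ := ⟨b, c⟩ with hz
  have hnorm : ‖z‖ = r := by
    rw [Complex.norm_def, Complex.normSq_mk, hr, sq, sq]
  have hre : r * cos z.arg = b := by simpa [hnorm] using Complex.norm_mul_cos_arg z
  have him : r * sin z.arg = c := by simpa [hnorm] using Complex.norm_mul_sin_arg z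
  have harg₀ : 0 ≤ z.arg := Complex.arg_nonneg_iff.2 hc.le
  have harg : z.arg < π / 2 := (abs_lt.1 (Complex.abs_arg_lt_pi_div_two_iff.2 (Or.inl hb))).2
  have heven : ∀ t : ℝ, sinh (|t| / 2) * sin (a * c * sinh |t|) * exp (-(a * b) * cosh |t|) =
      sinh (t / 2) * sin (a * r * sin z.arg * sinh t) * exp (-(a * r * cos z.arg) * cosh t) := by
    intro t
    rw [mul_assoc a r, mul_assoc a r, hre, him]
    rcases abs_choice t with h | h <;> rw [h]
    simp [neg_div]
  rw [integral_Ioi_eq_integral_Ioi_mul_sinh ha, setIntegral_congr_fun measurableSet_Ioi hsub,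
    integral_const_mul]
  have habs := integral_comp_abs
    (f := fun t => sinh (t / 2) * sin (a * c * sinh t) * exp (-(a * b) * cosh t))
  have hpos : ∫ t in Set.Ioi (0 : ℝ),
      sinh (|t| / 2) * sin (a * c * sinh |t|) * exp (-(a * b) * cosh |t|) =
      ∫ t in Set.Ioi (0 : ℝ), sinh (t / 2) * sin (a * c * sinh t) * exp (-(a * b) * cosh t) :=
    setIntegral_congr_fun measurableSet_Ioi fun t (ht : 0 < t) => by simp only [abs_of_pos ht]
  simp only [heven] at habs
  rw [integral_sinh_half_mul_sin_mul_exp (mul_pos ha hr₀) harg₀ harg,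
    sin_half_eq_sqrt harg₀ (by linarith [pi_pos]),
    eq_div_of_mul_eq hr₀.ne' ((mul_comm _ _).trans hre)] at habs
  have hsqrt : √(2 * a) * (√((1 - b / r) / 2) * √(π / (2 * (a * r)))) =
      √(π / 2) * √(r - b) / r := by
    have h₁ : 0 ≤ (1 - b / r) / 2 := by
      have := (div_lt_one hr₀).2 hbr
      linarith
    have h₂ : √(π / 2) * √(r - b) / r = √(π / 2 * (r - b) / r ^ 2) := by
      rw [sqrt_div' (π / 2 * (r - b)) (by positivity), sqrt_sq hr₀.le, sqrt_mul (by positivity)]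
    rw [h₂, ← sqrt_mul h₁, ← sqrt_mul (by positivity)]
    congr 1
    field_simp
  rw [hpos, ← hsqrt, neg_mul]
  linear_combination (-√(2 * a) / 2) * habs
end
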